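/- For each linearly stable equilibrium point x of F, the vertex occupation measure process satisfies ℙ( lim_{n→∞} X(n) = x ) > 0. -/

import Mathlib

open Filter MeasureTheory

def simplexD (d m : ℕ) : Set (Fin m → Fin d → ℝ) :=
  {x | ∀ i, (∀ v, 0 ≤ x i v) ∧ (∑ v, x i v) = 1}

noncomputable def piMap (d m : ℕ) (α : Fin d → Fin m → Fin m → ℝ)
    (x : Fin m → Fin d → ℝ) : Fin m → Fin d → ℝ :=
  fun i v => Real.exp (∑ j, α v i j * x j v) / ∑ u, Real.exp (∑ j, α u i j * x j u)

noncomputable def FF (d m : ℕ) (α : Fin d → Fin m → Fin m → ℝ)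
    (x : Fin m → Fin d → ℝ) : Fin m → Fin d → ℝ :=
  fun i v => -(x i v) + piMap d m α x i v

/-- The Jacobian matrix of `F` at `x`, with rows and columns indexed by pairs `(i, v)`:
entry `((i,v), (j,u))` is the partial derivative of `F_v^i` in the direction of the
coordinate `x_u^j`. -/
noncomputable def JF (d m : ℕ) (α : Fin d → Fin m → Fin m → ℝ)
    (x : Fin m → Fin d → ℝ) : Matrix (Fin m × Fin d) (Fin m × Fin d) ℝ :=
  Matrix.of fun p q =>
    fderiv ℝ (fun y => FF d m α y p.1 p.2) x (Pi.single q.1 (Pi.single q.2 (1 : ℝ)))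

/-- `x` is a linearly stable equilibrium: every eigenvalue of `JF(x)` has negative
real part. -/
noncomputable def LinStable (d m : ℕ) (α : Fin d → Fin m → Fin m → ℝ)
    (x : Fin m → Fin d → ℝ) : Prop :=
  ∀ μ ∈ spectrum ℂ ((JF d m α x).map (algebraMap ℝ ℂ)), μ.re < 0

noncomputable def occ (d m : ℕ) {Ω : Type*} (W : ℕ → Ω → Fin m → Fin d)
    (n : ℕ) (ω : Ω) : Fin m → Fin d → ℝ :=
  fun i v => (1 + ∑ k ∈ Finset.Icc 1 n, if W k ω i = v then (1 : ℝ) else 0) / (d + n)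

/-- Greedy construction of words with prescribed asymptotic letter frequencies. -/
lemma exists_word_balanced {d : ℕ} (p : Fin d → ℝ) (hp : ∀ v, 0 ≤ p v) (hsum : ∑ v, p v = 1)
    (n : ℕ) : ∃ s : ℕ → Fin d,
      ∑ v, ((∑ k ∈ Finset.Icc 1 n, if s k = v then (1 : ℝ) else 0) - n * p v) ^ 2 ≤ 2 * n := by
  induction n with
  | zero =>
    have : Nonempty (Fin d) := by
      by_contra h
      rw [not_nonempty_iff] at h
      simp at hsum
    exact ⟨fun _ => Classical.arbitrary _, by simp⟩
  | succ n ih =>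
    obtain ⟨s, hs⟩ := ih
    set D : Fin d → ℝ := fun v => (∑ k ∈ Finset.Icc 1 n, if s k = v then (1 : ℝ) else 0) - n * p v
      with hD
    obtain ⟨v, hv⟩ : ∃ v, D v ≤ ∑ u, p u * D u := by
      by_contra! h
      have h1 : ∀ v, p v * (∑ u, p u * D u) ≤ p v * D v := fun v =>
        mul_le_mul_of_nonneg_left (h v).le (hp v)
      obtain ⟨v, hv⟩ : ∃ v, 0 < p v := by
        by_contra! h0
        have : ∑ v, p v ≤ 0 := Finset.sum_nonpos fun v _ => h0 v
        linarith
      have h2 : ∑ v, p v * (∑ u, p u * D u) < ∑ v, p v * D v :=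
        Finset.sum_lt_sum (fun v _ => h1 v) ⟨v, Finset.mem_univ _, mul_lt_mul_of_pos_left (h v) hv⟩
      rw [← Finset.sum_mul, hsum, one_mul] at h2
      exact lt_irrefl _ h2
    refine ⟨Function.update s (n + 1) v, ?_⟩
    have hstep : ∀ u, (∑ k ∈ Finset.Icc 1 (n + 1),
        if Function.update s (n + 1) v k = u then (1 : ℝ) else 0) - ((n + 1 : ℕ) : ℝ) * p u
        = D u + ((if v = u then 1 else 0) - p u) := by
      intro u
      rw [Finset.sum_Icc_succ_top (by omega)]
      have : ∑ k ∈ Finset.Icc 1 n, (if Function.update s (n + 1) v k = u then (1 : ℝ) else 0)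
          = ∑ k ∈ Finset.Icc 1 n, if s k = u then (1 : ℝ) else 0 := by
        refine Finset.sum_congr rfl fun k hk => ?_
        rw [Function.update_of_ne]
        have := (Finset.mem_Icc.1 hk).2
        omega
      rw [this, Function.update_self, hD]
      push_cast
      ring
    simp_rw [hstep, add_sq, Finset.sum_add_distrib]
    have hcross : ∑ u, 2 * D u * ((if v = u then 1 else 0) - p u)
        = 2 * (D v - ∑ u, p u * D u) := by
      have : ∀ u, 2 * D u * ((if v = u then 1 else 0) - p u)
          = 2 * ((if v = u then D u else 0) - p u * D u) := by
        intro u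
        split_ifs <;> ring
      simp_rw [this, ← Finset.mul_sum, Finset.sum_sub_distrib]
      simp
    have hsq : ∑ u, ((if v = u then (1 : ℝ) else 0) - p u) ^ 2 ≤ 2 := by
      have hle : ∀ u, p u ≤ 1 := fun u => hsum ▸ Finset.single_le_sum (fun w _ => hp w) (by simp)
      have : ∀ u, ((if v = u then (1 : ℝ) else 0) - p u) ^ 2 ≤ (if v = u then 1 else 0) + p u := by
        intro u
        have := hp u
        have := hle u
        split_ifs <;> nlinarith
      refine (Finset.sum_le_sum fun u _ => this u).trans ?_
      rw [Finset.sum_add_distrib, hsum]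
      simp
      norm_num
    rw [hcross]
    push_cast
    linarith

open Matrix in
lemma dotProduct_mulVec_self_le {ι : Type*} [Fintype ι] (M : Matrix ι ι ℝ) (z : ι → ℝ) :
    (M *ᵥ z) ⬝ᵥ (M *ᵥ z) ≤ (∑ p, ∑ q, M p q ^ 2) * (z ⬝ᵥ z) := by
  simp only [dotProduct, mulVec]
  rw [Finset.sum_mul]
  refine Finset.sum_le_sum fun p _ => ?_
  have := Finset.sum_mul_sq_le_sq_mul_sq Finset.univ (M p) z
  simpa only [← sq] using this

open Matrix in
attribute [local instance] Matrix.linftyOpNormedRing Matrix.linftyOpNormedAlgebra in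
/-- Powers of a complex matrix whose spectrum lies in the open unit disc tend to zero. -/
lemma tendsto_matrix_pow_zero {ι : Type*} [Fintype ι] [DecidableEq ι] (M : Matrix ι ι ℂ)
    (h : ∀ μ ∈ spectrum ℂ M, ‖μ‖ < 1) (p q : ι) :
    Tendsto (fun n : ℕ => (M ^ n) p q) atTop (nhds 0) := by
  have : Nonempty ι := ⟨p⟩
  have : CompleteSpace (Matrix ι ι ℂ) := FiniteDimensional.complete ℂ _
  have hr : spectralRadius ℂ M < 1 := by
    have := spectrum.spectralRadius_lt_of_forall_lt (r := 1) M (fun k hk => by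
      rw [← NNReal.coe_lt_coe]; simpa using h k hk)
    simpa using this
  obtain ⟨ρ, hρ1, hρ2⟩ := ENNReal.lt_iff_exists_nnreal_btwn.1 hr
  have hρ : ρ < 1 := by exact_mod_cast hρ2
  have hev := (spectrum.pow_nnnorm_pow_one_div_tendsto_nhds_spectralRadius M).eventually_lt_const hρ1
  have hev2 : ∀ᶠ n : ℕ in atTop, ‖M ^ n‖ ≤ (ρ : ℝ) ^ n := by
    filter_upwards [hev, eventually_ge_atTop 1] with n hn hn1
    have hn0 : (n : ℝ) ≠ 0 := by positivity
    have h1 := ENNReal.rpow_le_rpow hn.le (z := (n : ℝ)) (by positivity)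
    rw [← ENNReal.rpow_mul, one_div, inv_mul_cancel₀ hn0, ENNReal.rpow_one,
      ENNReal.rpow_natCast] at h1
    have h2 : ‖M ^ n‖₊ ≤ ρ ^ n := by exact_mod_cast h1
    exact_mod_cast h2
  have h0 : Tendsto (fun n : ℕ => M ^ n) atTop (nhds 0) := by
    refine squeeze_zero_norm' hev2 ?_
    exact tendsto_pow_atTop_nhds_zero_of_lt_one ρ.2 (by exact_mod_cast hρ)
  exact ((continuous_apply q).tendsto _).comp (((continuous_apply p).tendsto _).comp h0)

/-- For a complex Hurwitz matrix `M`, the spectrum of `1 + ε M` lies in the open unit disc for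
some `ε > 0`. -/
lemma exists_step_spectrum_disc {ι : Type*} [Fintype ι] [DecidableEq ι] (M : Matrix ι ι ℂ)
    (h : ∀ μ ∈ spectrum ℂ M, μ.re < 0) :
    ∃ ε : ℝ, 0 < ε ∧ ∀ μ ∈ spectrum ℂ (1 + (ε : ℂ) • M), ‖μ‖ < 1 := by
  have key : ∀ μ ∈ spectrum ℂ M, ∀ᶠ ε : ℝ in nhdsWithin 0 (Set.Ioi 0), ‖1 + (ε : ℂ) * μ‖ < 1 := by
    intro μ hμ
    have hre := h μ hμ
    have hc : Tendsto (fun ε : ℝ => 2 * μ.re + ε * (μ.re ^ 2 + μ.im ^ 2))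
        (nhdsWithin 0 (Set.Ioi 0)) (nhds (2 * μ.re)) := by
      have : Continuous (fun ε : ℝ => 2 * μ.re + ε * (μ.re ^ 2 + μ.im ^ 2)) := by fun_prop
      have h2 := this.tendsto 0
      simp only [zero_mul, add_zero] at h2
      exact h2.mono_left nhdsWithin_le_nhds
    filter_upwards [hc.eventually_lt_const (show 2 * μ.re < 0 by linarith),
      self_mem_nhdsWithin] with ε hε hε0
    have hε0' : (0 : ℝ) < ε := hε0
    have hsq : ‖1 + (ε : ℂ) * μ‖ ^ 2 < 1 := by
      rw [Complex.sq_norm, Complex.normSq_apply]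
      simp
      nlinarith
    nlinarith [norm_nonneg (1 + (ε : ℂ) * μ)]
  have hfin : (spectrum ℂ M).Finite := Matrix.finite_spectrum M
  obtain ⟨ε, hε, hpos⟩ := (((hfin.eventually_all).2 key).and
    (self_mem_nhdsWithin : Set.Ioi (0 : ℝ) ∈ nhdsWithin 0 (Set.Ioi 0))).exists
  have hpos' : (0 : ℝ) < ε := hpos
  refine ⟨ε, hpos', fun μ hμ => ?_⟩
  have hne : (ε : ℂ) ≠ 0 := by exact_mod_cast hpos'.ne'
  have h1 : (1 : Matrix ι ι ℂ) = algebraMap ℂ _ 1 := by simp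
  rw [h1, ← spectrum.singleton_add_eq] at hμ
  obtain ⟨_, rfl, ν, hν, rfl⟩ := hμ
  have h2 : (ε : ℂ) • M = (Units.mk0 (ε : ℂ) hne) • M := rfl
  rw [h2, spectrum.unit_smul_eq_smul] at hν
  obtain ⟨lam, hlam, rfl⟩ := hν
  exact hε lam hlam

open Matrix in
/-- Lyapunov's theorem: a real Hurwitz matrix admits a quadratic strict Lyapunov function. -/
lemma exists_quadratic_lyapunov {ι : Type*} [Fintype ι] [DecidableEq ι] (A : Matrix ι ι ℝ)
    (h : ∀ μ ∈ spectrum ℂ (A.map (algebraMap ℝ ℂ)), μ.re < 0) :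
    ∃ P : Matrix ι ι ℝ, P.IsSymm ∧ (∀ z, z ⬝ᵥ z ≤ z ⬝ᵥ (P *ᵥ z)) ∧
      ∃ c : ℝ, 0 < c ∧ ∀ z, z ⬝ᵥ (P *ᵥ (A *ᵥ z)) ≤ -c * (z ⬝ᵥ z) := by
  obtain ⟨ε, hε, hdisc⟩ := exists_step_spectrum_disc _ h
  set T : Matrix ι ι ℝ := 1 + ε • A with hT
  have hTmap : T.map (algebraMap ℝ ℂ) = 1 + (ε : ℂ) • A.map (algebraMap ℝ ℂ) := by
    ext i j
    simp [hT, Matrix.one_apply, apply_ite]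
  have hentry : ∀ p q, Tendsto (fun n : ℕ => (T ^ n) p q) atTop (nhds 0) := by
    intro p q
    have h1 := tendsto_matrix_pow_zero (T.map (algebraMap ℝ ℂ)) (by rwa [hTmap]) p q
    have h2 : ∀ n : ℕ, ((T.map (algebraMap ℝ ℂ)) ^ n) p q = (((T ^ n) p q : ℝ) : ℂ) := by
      intro n
      have := Matrix.map_pow (f := algebraMap ℝ ℂ) (M := T) n
      rw [← this]
      simp
    simp_rw [h2] at h1
    simpa [Function.comp_def] using (Complex.continuous_re.tendsto _).comp h1
  have hsum : Tendsto (fun n : ℕ => ∑ p, ∑ q, ((T ^ n) p q) ^ 2) atTop (nhds 0) := by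
    have := tendsto_finsetSum Finset.univ fun p (_ : p ∈ Finset.univ) =>
      tendsto_finsetSum Finset.univ fun q (_ : q ∈ Finset.univ) => (hentry p q).pow 2
    simpa using this
  obtain ⟨N, hN0, hN⟩ := ((eventually_ge_atTop 1).and
    (hsum.eventually_lt_const (show (0 : ℝ) < 1 / 2 by norm_num))).exists
  set P : Matrix ι ι ℝ := ∑ k ∈ Finset.range N, (T ^ k)ᵀ * T ^ k with hP
  have hPq : ∀ y z, y ⬝ᵥ (P *ᵥ z)
      = ∑ k ∈ Finset.range N, (T ^ k *ᵥ y) ⬝ᵥ (T ^ k *ᵥ z) := by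
    intro y z
    rw [hP, Matrix.sum_mulVec, dotProduct_sum]
    refine Finset.sum_congr rfl fun k _ => ?_
    rw [← Matrix.mulVec_mulVec, dotProduct_mulVec, vecMul_transpose]
  have hnn : ∀ y : ι → ℝ, 0 ≤ y ⬝ᵥ y := fun y =>
    Finset.sum_nonneg fun i _ => mul_self_nonneg _
  refine ⟨P, ?_, fun z => ?_, 1 / (4 * ε), by positivity, fun z => ?_⟩
  · rw [Matrix.IsSymm, hP, Matrix.transpose_sum]
    simp
  · rw [hPq]
    have := Finset.single_le_sum (f := fun k => (T ^ k *ᵥ z) ⬝ᵥ (T ^ k *ᵥ z))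
      (fun k _ => hnn _) (Finset.mem_range.2 (show 0 < N by omega))
    simpa using this
  · have h1 : (T *ᵥ z) ⬝ᵥ (P *ᵥ (T *ᵥ z))
        = z ⬝ᵥ (P *ᵥ z) - z ⬝ᵥ z + (T ^ N *ᵥ z) ⬝ᵥ (T ^ N *ᵥ z) := by
      rw [hPq, hPq]
      have := Finset.sum_range_succ' (fun k => (T ^ k *ᵥ z) ⬝ᵥ (T ^ k *ᵥ z)) N
      rw [Finset.sum_range_succ] at this
      simp only [Matrix.mulVec_mulVec, ← pow_succ]
      simp at this
      linarith
    have h2 : (T *ᵥ z) ⬝ᵥ (P *ᵥ (T *ᵥ z)) = z ⬝ᵥ (P *ᵥ z) + 2 * ε * (z ⬝ᵥ (P *ᵥ (A *ᵥ z)))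
        + ε ^ 2 * ((A *ᵥ z) ⬝ᵥ (P *ᵥ (A *ᵥ z))) := by
      have hs : (A *ᵥ z) ⬝ᵥ (P *ᵥ z) = z ⬝ᵥ (P *ᵥ (A *ᵥ z)) := by
        rw [hPq, hPq]
        exact Finset.sum_congr rfl fun k _ => dotProduct_comm _ _
      rw [hT]
      simp only [Matrix.add_mulVec, Matrix.smul_mulVec, Matrix.one_mulVec, Matrix.mulVec_add,
        Matrix.mulVec_smul, add_dotProduct, dotProduct_add, smul_dotProduct, dotProduct_smul,
        smul_eq_mul, hs]
      ring
    have h3 : 0 ≤ (A *ᵥ z) ⬝ᵥ (P *ᵥ (A *ᵥ z)) := by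
      rw [hPq]
      exact Finset.sum_nonneg fun k _ => hnn _
    have h4 := dotProduct_mulVec_self_le (T ^ N) z
    have h5 : 2 * ε * (z ⬝ᵥ (P *ᵥ (A *ᵥ z))) ≤ -(1 / 2) * (z ⬝ᵥ z) := by
      nlinarith [hnn z, mul_nonneg (sq_nonneg ε) h3]
    rw [show -(1 / (4 * ε)) * (z ⬝ᵥ z) = (-(1 / 2) * (z ⬝ᵥ z)) / (2 * ε) by field_simp; ring,
      le_div_iff₀ (by positivity)]
    linarith

/-- Coordinates of a point of `ℝ^{dm}`, indexed by pairs as in the Jacobian matrix. -/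
def flat {d m : ℕ} (z : Fin m → Fin d → ℝ) : Fin m × Fin d → ℝ := fun p => z p.1 p.2

lemma abs_flat_le {d m : ℕ} (z : Fin m → Fin d → ℝ) (p : Fin m × Fin d) : |flat z p| ≤ ‖z‖ :=
  (norm_le_pi_norm (z p.1) p.2).trans (norm_le_pi_norm z p.1)

open Matrix in
lemma norm_sq_le_flat {d m : ℕ} (z : Fin m → Fin d → ℝ) : ‖z‖ ^ 2 ≤ flat z ⬝ᵥ flat z := by
  have h0 : 0 ≤ flat z ⬝ᵥ flat z := Finset.sum_nonneg fun _ _ => mul_self_nonneg _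
  rw [← Real.le_sqrt (norm_nonneg _) h0]
  refine (pi_norm_le_iff_of_nonneg (Real.sqrt_nonneg _)).2 fun i =>
    (pi_norm_le_iff_of_nonneg (Real.sqrt_nonneg _)).2 fun v => ?_
  rw [Real.norm_eq_abs]
  refine Real.abs_le_sqrt ?_
  rw [sq]
  exact Finset.single_le_sum (f := fun p => flat z p * flat z p) (fun _ _ => mul_self_nonneg _)
    (Finset.mem_univ (i, v))

open Matrix in
lemma dotProduct_mulVec_le_of_abs_le {ι : Type*} [Fintype ι] (P : Matrix ι ι ℝ) {y z : ι → ℝ}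
    {a b : ℝ} (hy : ∀ p, |y p| ≤ a) (hz : ∀ p, |z p| ≤ b) :
    y ⬝ᵥ (P *ᵥ z) ≤ a * b * ∑ p, ∑ q, |P p q| := by
  simp only [dotProduct, mulVec, Finset.mul_sum]
  refine Finset.sum_le_sum fun p _ => Finset.sum_le_sum fun q _ => ?_
  have h1 : |y p| * |z q| ≤ a * b :=
    mul_le_mul (hy p) (hz q) (abs_nonneg _) ((abs_nonneg _).trans (hy p))
  calc y p * (P p q * z q) ≤ |y p * (P p q * z q)| := le_abs_self _
    _ = |y p| * |z q| * |P p q| := by rw [abs_mul, abs_mul]; ring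
    _ ≤ _ := mul_le_mul_of_nonneg_right h1 (abs_nonneg _)

lemma sum_exp_pos {d m : ℕ} (α : Fin d → Fin m → Fin m → ℝ) (y : Fin m → Fin d → ℝ)
    (i : Fin m) (v : Fin d) : 0 < ∑ u, Real.exp (∑ j, α u i j * y j u) :=
  Finset.sum_pos (fun _ _ => Real.exp_pos _) ⟨v, Finset.mem_univ _⟩

lemma piMap_pos {d m : ℕ} (α : Fin d → Fin m → Fin m → ℝ) (y : Fin m → Fin d → ℝ)
    (i : Fin m) (v : Fin d) : 0 < piMap d m α y i v :=
  div_pos (Real.exp_pos _) (sum_exp_pos α y i v)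

lemma differentiable_FF {d m : ℕ} (α : Fin d → Fin m → Fin m → ℝ) (i : Fin m) (v : Fin d) :
    Differentiable ℝ fun y => FF d m α y i v := by
  unfold FF piMap
  have h := fun y => (sum_exp_pos α y i v).ne'
  fun_prop (disch := assumption)

open Matrix in
lemma fderiv_FF_apply {d m : ℕ} (α : Fin d → Fin m → Fin m → ℝ) (x z : Fin m → Fin d → ℝ)
    (p : Fin m × Fin d) :
    fderiv ℝ (fun y => FF d m α y p.1 p.2) x z = (JF d m α x *ᵥ flat z) p := by
  have hz : z = ∑ q : Fin m × Fin d, flat z q • Pi.single q.1 (Pi.single q.2 (1 : ℝ)) := by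
    ext i v
    simp [Finset.sum_apply, flat, Fintype.sum_prod_type, Pi.single_apply, ite_apply]
  conv_lhs => rw [hz]
  simp [mulVec, dotProduct, JF, map_sum, mul_comm]

open Matrix in
/-- Near a linearly stable equilibrium, a quadratic form strictly decreases along `F`. -/
lemma exists_lyapunov_drift {d m : ℕ} (α : Fin d → Fin m → Fin m → ℝ) (x : Fin m → Fin d → ℝ)
    (hxeq : FF d m α x = 0) (hxstable : LinStable d m α x) :
    ∃ P : Matrix (Fin m × Fin d) (Fin m × Fin d) ℝ, P.IsSymm ∧
      (∀ z, z ⬝ᵥ z ≤ z ⬝ᵥ (P *ᵥ z)) ∧ ∃ r : ℝ, 0 < r ∧ ∃ c : ℝ, 0 < c ∧ ∀ y,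
        flat (y - x) ⬝ᵥ (P *ᵥ flat (y - x)) ≤ r →
        flat (y - x) ⬝ᵥ (P *ᵥ flat (FF d m α y)) ≤
          -c * (flat (y - x) ⬝ᵥ (P *ᵥ flat (y - x))) := by
  obtain ⟨P, hsymm, hPpos, c, hc, hA⟩ := exists_quadratic_lyapunov _ hxstable
  set S : ℝ := 1 + ∑ p, ∑ q, |P p q| with hS
  have hS0 : 0 ≤ ∑ p, ∑ q, |P p q| :=
    Finset.sum_nonneg fun _ _ => Finset.sum_nonneg fun _ _ => abs_nonneg _
  have hS1 : 0 < S := by linarith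
  have hlin : ∀ p : Fin m × Fin d, ∀ᶠ y in nhds x,
      ‖FF d m α y p.1 p.2 - (JF d m α x *ᵥ flat (y - x)) p‖ ≤ c / (2 * S) * ‖y - x‖ := by
    intro p
    have h := (differentiable_FF α p.1 p.2 x).hasFDerivAt.isLittleO.def
      (show 0 < c / (2 * S) by positivity)
    filter_upwards [h] with y hy
    rw [fderiv_FF_apply, hxeq] at hy
    simpa using hy
  obtain ⟨ρ, hρ, hball⟩ := Metric.eventually_nhds_iff.1 (eventually_all.2 hlin)
  refine ⟨P, hsymm, hPpos, ρ ^ 2 / 2, by positivity, c / (2 * S), by positivity, fun y hy => ?_⟩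
  set z := y - x with hz
  have hzz := norm_sq_le_flat z
  have hnear : dist y x < ρ := by
    rw [dist_eq_norm]
    have := hPpos (flat z)
    have : ‖z‖ ^ 2 < ρ ^ 2 := by have := pow_pos hρ 2; linarith
    exact lt_of_pow_lt_pow_left₀ 2 hρ.le this
  have hrem := hball hnear
  set R : Fin m × Fin d → ℝ := flat (FF d m α y) - JF d m α x *ᵥ flat z with hR
  have hFR : flat (FF d m α y) = JF d m α x *ᵥ flat z + R := by rw [hR]; abel
  have h1 : flat z ⬝ᵥ (P *ᵥ R) ≤ ‖z‖ * (c / (2 * S) * ‖z‖) * ∑ p, ∑ q, |P p q| :=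
    dotProduct_mulVec_le_of_abs_le P (abs_flat_le z) hrem
  have h2 : flat z ⬝ᵥ (P *ᵥ R) ≤ c / 2 * ‖z‖ ^ 2 := by
    refine h1.trans ?_
    have : ‖z‖ * (c / (2 * S) * ‖z‖) * ∑ p, ∑ q, |P p q| ≤ ‖z‖ * (c / (2 * S) * ‖z‖) * S :=
      mul_le_mul_of_nonneg_left (by linarith) (by positivity)
    refine this.trans (le_of_eq ?_)
    field_simp
  have h3 : flat z ⬝ᵥ (P *ᵥ flat z) ≤ ‖z‖ * ‖z‖ * ∑ p, ∑ q, |P p q| :=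
    dotProduct_mulVec_le_of_abs_le P (abs_flat_le z) (abs_flat_le z)
  have h4 : flat z ⬝ᵥ (P *ᵥ flat z) ≤ S * (flat z ⬝ᵥ flat z) := by
    refine h3.trans ?_
    nlinarith [sq_nonneg ‖z‖, mul_le_mul_of_nonneg_left hzz hS1.le]
  rw [hFR, mulVec_add, dotProduct_add]
  have h5 := hA (flat z)
  have h6 : c / (2 * S) * (flat z ⬝ᵥ (P *ᵥ flat z)) ≤ c / 2 * (flat z ⬝ᵥ flat z) := by
    refine (mul_le_mul_of_nonneg_left h4 (by positivity)).trans (le_of_eq ?_)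
    field_simp
  have h7 : c / 2 * ‖z‖ ^ 2 ≤ c / 2 * (flat z ⬝ᵥ flat z) :=
    mul_le_mul_of_nonneg_left hzz (by positivity)
  linarith

lemma setIntegral_mul_of_condExp_ae_eq {Ω : Type*} {m m₀ : MeasurableSpace Ω} {μ : Measure Ω}
    [IsFiniteMeasure μ] (hm : m ≤ m₀) {f ξ h : Ω → ℝ} (hf : StronglyMeasurable[m] f) {C : ℝ}
    (hC : ∀ ω, |f ω| ≤ C) (hξ : Integrable ξ μ) (hcond : μ[ξ | m] =ᵐ[μ] h) {E : Set Ω}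
    (hE : MeasurableSet[m] E) : ∫ ω in E, f ω * ξ ω ∂μ = ∫ ω in E, f ω * h ω ∂μ := by
  have hZint : Integrable (f * ξ) μ :=
    hξ.bdd_mul (hf.mono hm).aestronglyMeasurable (ae_of_all _ fun ω => by simpa using hC ω)
  have h1 := condExp_stronglyMeasurable_mul_of_bound hm hf hξ C
    (ae_of_all _ fun ω => by simpa using hC ω)
  have h2 := setIntegral_condExp hm hZint hE
  refine h2.symm.trans (setIntegral_congr_ae (hm _ hE) ?_)
  filter_upwards [h1, hcond] with ω hω1 hω2 _
  rw [hω1, Pi.mul_apply, hω2]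

/-- A maximal inequality for an almost supermartingale whose one-step bound is only available
below the level `R`. -/
lemma measure_forall_le_pos_of_step {Ω : Type*} {m₀ : MeasurableSpace Ω} {μ : Measure Ω}
    [IsFiniteMeasure μ] {ℱ : Filtration ℕ m₀} {Z : ℕ → Ω → ℝ}
    (hZ : ∀ n, Measurable[ℱ n] (Z n)) (hZint : ∀ n, Integrable (Z n) μ) (hnn : ∀ n ω, 0 ≤ Z n ω)
    {n₀ : ℕ} {R : ℝ} (hR : 0 < R) {b : ℕ → ℝ} (hb0 : ∀ n, 0 ≤ b n)
    (hb : ∀ n, ∑ k ∈ Finset.Ico n₀ n, b k ≤ R / 4)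
    (hstep : ∀ n, n₀ ≤ n → ∀ E, MeasurableSet[ℱ n] E → (∀ ω ∈ E, Z n ω ≤ R) →
      ∫ ω in E, Z (n + 1) ω ∂μ ≤ ∫ ω in E, Z n ω ∂μ + b n * μ.real E)
    {A : Set Ω} (hA : MeasurableSet[ℱ n₀] A) (hAZ : ∀ ω ∈ A, Z n₀ ω ≤ R / 4) (hApos : 0 < μ A) :
    0 < μ (A ∩ {ω | ∀ n, n₀ ≤ n → Z n ω ≤ R}) := by
  set E : ℕ → Set Ω := fun j => A ∩ {ω | ∀ k ∈ Finset.Icc n₀ (n₀ + j), Z k ω ≤ R} with hE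
  have hEm : ∀ j, MeasurableSet[ℱ (n₀ + j)] (E j) := by
    intro j
    refine (ℱ.mono (Nat.le_add_right _ _) _ hA).inter ?_
    rw [Set.ofPred_forall]
    refine MeasurableSet.iInter fun k => ?_
    rw [Set.ofPred_forall]
    refine MeasurableSet.iInter fun hk => ?_
    exact ((hZ k).mono (ℱ.mono (Finset.mem_Icc.1 hk).2) le_rfl) measurableSet_Iic
  have hEm0 : ∀ j, MeasurableSet (E j) := fun j => ℱ.le _ _ (hEm j)
  have hEsub : ∀ j, E (j + 1) ⊆ E j := fun j ω hω =>
    ⟨hω.1, fun k hk => hω.2 k (by simp only [Finset.mem_Icc] at hk ⊢; omega)⟩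
  have hEanti : Antitone E := antitone_nat_of_succ_le hEsub
  have hE0 : E 0 = A := by
    refine Set.Subset.antisymm (fun ω hω => hω.1) fun ω hω => ⟨hω, fun k hk => ?_⟩
    have : k = n₀ := by simp only [Finset.mem_Icc] at hk; omega
    rw [this]
    linarith [hAZ ω hω]
  have hEA : ∀ j, μ.real (E j) ≤ μ.real A := fun j => measureReal_mono fun ω hω => hω.1
  have key : ∀ j, ∫ ω in E j, Z (n₀ + j) ω ∂μ + R * (μ.real A - μ.real (E j))
      ≤ (R / 4 + ∑ k ∈ Finset.Ico n₀ (n₀ + j), b k) * μ.real A := by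
    intro j
    induction j with
    | zero =>
      rw [hE0]
      have h1 : ∫ ω in A, Z n₀ ω ∂μ ≤ ∫ _ in A, R / 4 ∂μ :=
        setIntegral_mono_on (hZint n₀).integrableOn (integrable_const _) (ℱ.le _ _ hA) hAZ
      simp only [setIntegral_const, smul_eq_mul] at h1
      simp only [add_zero, Finset.Ico_self, Finset.sum_empty, sub_self, mul_zero]
      linarith
    | succ j ih =>
      have h1 := hstep (n₀ + j) (Nat.le_add_right _ _) (E j) (hEm j)
        fun ω hω => hω.2 _ (by simp)
      have h2 : ∫ ω in E j, Z (n₀ + j + 1) ω ∂μ = ∫ ω in E (j + 1), Z (n₀ + j + 1) ω ∂μ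
          + ∫ ω in E j \ E (j + 1), Z (n₀ + j + 1) ω ∂μ := by
        rw [← setIntegral_union Set.disjoint_sdiff_right ((hEm0 _).diff (hEm0 _))
          (hZint _).integrableOn (hZint _).integrableOn, Set.union_sdiff_cancel (hEsub j)]
      have h3 : R * (μ.real (E j) - μ.real (E (j + 1)))
          ≤ ∫ ω in E j \ E (j + 1), Z (n₀ + j + 1) ω ∂μ := by
        have h4 : ∫ _ in E j \ E (j + 1), R ∂μ ≤ ∫ ω in E j \ E (j + 1), Z (n₀ + j + 1) ω ∂μ := by
          refine setIntegral_mono_on (integrable_const _) (hZint _).integrableOn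
            ((hEm0 _).diff (hEm0 _)) fun ω hω => ?_
          by_contra! hlt
          refine hω.2 ⟨hω.1.1, fun k hk => ?_⟩
          rcases eq_or_ne k (n₀ + j + 1) with rfl | hne
          · exact hlt.le
          · exact hω.1.2 k (by simp only [Finset.mem_Icc] at hk ⊢; omega)
        rw [setIntegral_const, smul_eq_mul, measureReal_sdiff (hEsub j) (hEm0 _)] at h4
        linarith
      have h5 : b (n₀ + j) * μ.real (E j) ≤ b (n₀ + j) * μ.real A :=
        mul_le_mul_of_nonneg_left (hEA j) (hb0 _)
      rw [← add_assoc, Finset.sum_Ico_succ_top (Nat.le_add_right _ _)]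
      linarith
  have hlow : ∀ j, μ.real A / 2 ≤ μ.real (E j) := by
    intro j
    have h1 := key j
    have h2 : 0 ≤ ∫ ω in E j, Z (n₀ + j) ω ∂μ := integral_nonneg fun ω => hnn _ ω
    have h3 : (R / 4 + ∑ k ∈ Finset.Ico n₀ (n₀ + j), b k) * μ.real A ≤ R / 2 * μ.real A :=
      mul_le_mul_of_nonneg_right (by linarith [hb (n₀ + j)]) measureReal_nonneg
    have h4 : R * (μ.real A / 2) ≤ R * μ.real (E j) := by linarith
    exact le_of_mul_le_mul_left h4 hR
  have hAreal : 0 < μ.real A := ENNReal.toReal_pos hApos.ne' (measure_ne_top _ _)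
  have hinter : ENNReal.ofReal (μ.real A / 2) ≤ μ (⋂ j, E j) := by
    refine ge_of_tendsto' (tendsto_measure_iInter_atTop
      (fun j => (hEm0 j).nullMeasurableSet) hEanti ⟨0, measure_ne_top _ _⟩) fun j => ?_
    rw [Function.comp_apply, ← ofReal_measureReal (μ := μ) (s := E j)]
    exact ENNReal.ofReal_le_ofReal (hlow j)
  refine (ENNReal.ofReal_pos.2 (half_pos hAreal)).trans_le (hinter.trans (measure_mono ?_))
  intro ω hω
  rw [Set.mem_iInter] at hω
  refine ⟨(hω 0).1, fun n hn => (hω (n - n₀)).2 n ?_⟩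
  simp only [Finset.mem_Icc]
  omega

lemma measurableSet_preimage_of_mem_Icc {d m : ℕ} {Ω : Type*} {m₀ : MeasurableSpace Ω}
    {W : ℕ → Ω → Fin m → Fin d} {ℱ : Filtration ℕ m₀}
    (hℱ : ∀ n, ℱ n = ⨆ k ∈ Finset.Icc 1 n, MeasurableSpace.comap (W k) ⊤) {n k : ℕ}
    (hk : k ∈ Finset.Icc 1 n) (S : Set (Fin m → Fin d)) : MeasurableSet[ℱ n] (W k ⁻¹' S) := by
  have hle : MeasurableSpace.comap (W k) ⊤ ≤ ℱ n := by
    rw [hℱ n]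
    exact le_iSup₂_of_le k hk le_rfl
  exact hle _ ⟨S, trivial, rfl⟩

lemma measurable_occ_of_preimage {d m : ℕ} {Ω : Type*} [MeasurableSpace Ω]
    {W : ℕ → Ω → Fin m → Fin d} {n : ℕ}
    (h : ∀ k ∈ Finset.Icc 1 n, ∀ S : Set (Fin m → Fin d), MeasurableSet (W k ⁻¹' S)) :
    Measurable (occ d m W n) := by
  refine measurable_pi_lambda _ fun i => measurable_pi_lambda _ fun v => ?_
  unfold occ
  refine Measurable.div_const (Measurable.const_add ?_ _) _
  exact Finset.measurable_sum _ fun k hk =>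
    Measurable.ite (h k hk {u | u i = v}) measurable_const measurable_const

lemma measurable_occ {d m : ℕ} {Ω : Type*} {m₀ : MeasurableSpace Ω}
    {W : ℕ → Ω → Fin m → Fin d} {ℱ : Filtration ℕ m₀}
    (hℱ : ∀ n, ℱ n = ⨆ k ∈ Finset.Icc 1 n, MeasurableSpace.comap (W k) ⊤) (n : ℕ) :
    Measurable[ℱ n] (occ d m W n) :=
  @measurable_occ_of_preimage d m Ω (ℱ n) W n
    fun _ hk S => measurableSet_preimage_of_mem_Icc hℱ hk S

lemma occ_mem_Icc {d m : ℕ} {Ω : Type*} {W : ℕ → Ω → Fin m → Fin d}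
    (n : ℕ) (ω : Ω) (i : Fin m) (v : Fin d) :
    occ d m W n ω i v ∈ Set.Icc (0 : ℝ) 1 := by
  have hd : (1 : ℝ) ≤ d := by exact_mod_cast (Fin.pos v)
  have h0 : 0 ≤ ∑ k ∈ Finset.Icc 1 n, (if W k ω i = v then (1 : ℝ) else 0) :=
    Finset.sum_nonneg fun _ _ => by split_ifs <;> norm_num
  have h1 : ∑ k ∈ Finset.Icc 1 n, (if W k ω i = v then (1 : ℝ) else 0) ≤ n := by
    refine (Finset.sum_le_sum (g := fun _ => (1 : ℝ)) fun _ _ => by split_ifs <;> norm_num).trans ?_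
    simp
  have hn : (0 : ℝ) ≤ n := Nat.cast_nonneg n
  refine ⟨div_nonneg (by linarith) (by linarith), (div_le_one (by linarith)).2 (by linarith)⟩

lemma occ_succ {d m : ℕ} {Ω : Type*} {W : ℕ → Ω → Fin m → Fin d}
    (n : ℕ) (ω : Ω) (i : Fin m) (v : Fin d) :
    occ d m W (n + 1) ω i v = occ d m W n ω i v
      + 1 / (d + n + 1) * ((if W (n + 1) ω i = v then 1 else 0) - occ d m W n ω i v) := by
  have hd : (1 : ℝ) ≤ d := by exact_mod_cast (Fin.pos v)
  have h1 : (d : ℝ) + n ≠ 0 := by positivity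
  have h2 : (d : ℝ) + n + 1 ≠ 0 := by positivity
  simp only [occ]
  rw [Finset.sum_Icc_succ_top (by omega)]
  push_cast
  rw [← add_assoc (d : ℝ)]
  field_simp
  ring

/-- Every finite word is realised with positive probability. -/
lemma measure_word_pos {d m : ℕ} {Ω : Type*} [MeasurableSpace Ω]
    {W : ℕ → Ω → Fin m → Fin d} {ℱ : Filtration ℕ ‹MeasurableSpace Ω›}
    (ℙ : Measure Ω) [IsProbabilityMeasure ℙ] (α : Fin d → Fin m → Fin m → ℝ)
    (hℱ : ∀ n, ℱ n = ⨆ k ∈ Finset.Icc 1 n, MeasurableSpace.comap (W k) ⊤)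
    (hindep : ∀ n (v : Fin m → Fin d),
      (ℙ[fun ω => if (∀ i, W (n + 1) ω i = v i) then (1 : ℝ) else 0 | ℱ n])
        =ᵐ[ℙ] fun ω => ∏ i, piMap d m α (occ d m W n ω) i (v i))
    (w : ℕ → Fin m → Fin d) (n : ℕ) :
    MeasurableSet[ℱ n] {ω | ∀ k ∈ Finset.Icc 1 n, W k ω = w k} ∧
      0 < ℙ {ω | ∀ k ∈ Finset.Icc 1 n, W k ω = w k} := by
  have hmeas : ∀ n, MeasurableSet[ℱ n] {ω | ∀ k ∈ Finset.Icc 1 n, W k ω = w k} := by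
    intro n
    rw [Set.ofPred_forall]
    refine MeasurableSet.iInter fun k => ?_
    rw [Set.ofPred_forall]
    refine MeasurableSet.iInter fun hk => ?_
    exact measurableSet_preimage_of_mem_Icc hℱ hk {w k}
  refine ⟨hmeas n, ?_⟩
  induction n with
  | zero => simp
  | succ n ih =>
    set A : Set Ω := {ω | ∀ k ∈ Finset.Icc 1 n, W k ω = w k} with hA
    set B : Set Ω := {ω | ∀ i, W (n + 1) ω i = w (n + 1) i} with hB
    have hBm : MeasurableSet B :=
      (ℱ.le _) _ (measurableSet_preimage_of_mem_Icc hℱ (n := n + 1) (k := n + 1)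
        (by simp) {u | ∀ i, u i = w (n + 1) i})
    have hAB : {ω | ∀ k ∈ Finset.Icc 1 (n + 1), W k ω = w k} = B ∩ A := by
      ext ω
      simp only [hA, hB, Set.mem_ofPred_eq, Set.mem_inter_iff, Finset.mem_Icc]
      constructor
      · exact fun h => ⟨fun i => congrFun (h (n + 1) ⟨by omega, le_rfl⟩) i,
          fun k hk => h k ⟨hk.1, by omega⟩⟩
      · rintro ⟨h1, h2⟩ k hk
        rcases eq_or_ne k (n + 1) with rfl | hne
        · exact funext h1
        · exact h2 k ⟨hk.1, by omega⟩
    set X₀ : Fin m → Fin d → ℝ := occ d m (fun k (_ : Unit) => w k) n () with hX₀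
    have hocc : ∀ ω ∈ A, occ d m W n ω = X₀ := by
      intro ω hω
      ext i v
      simp only [hX₀, occ]
      congr 2
      exact Finset.sum_congr rfl fun k hk => by rw [hω k hk]
    have hind : (fun ω => if (∀ i, W (n + 1) ω i = w (n + 1) i) then (1 : ℝ) else 0)
        = B.indicator fun _ => 1 := by
      ext ω
      simp [Set.indicator_apply, hB]
    have h1 := setIntegral_condExp (ℱ.le n)
      ((integrable_const (1 : ℝ)).indicator hBm : Integrable (B.indicator fun _ => (1 : ℝ)) ℙ)
      (hmeas n)
    have h2 := hindep n (w (n + 1))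
    rw [hind] at h2
    have h3 : ∫ ω in A, (ℙ[B.indicator fun _ => (1 : ℝ) | ℱ n]) ω ∂ℙ
        = ∫ _ in A, ∏ i, piMap d m α X₀ i (w (n + 1) i) ∂ℙ := by
      refine setIntegral_congr_ae ((ℱ.le n) _ (hmeas n)) ?_
      filter_upwards [h2] with ω hω hωA
      rw [hω, hocc ω hωA]
    rw [h3, setIntegral_indicator hBm, setIntegral_const, setIntegral_const] at h1
    have hpos : 0 < ℙ.real A := ENNReal.toReal_pos ih.ne' (measure_ne_top _ _)
    have hprod : 0 < ∏ i, piMap d m α X₀ i (w (n + 1) i) :=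
      Finset.prod_pos fun i _ => piMap_pos α X₀ i _
    have h4 : 0 < ℙ.real (A ∩ B) := by
      simp only [smul_eq_mul, mul_one] at h1
      rw [← h1]
      exact mul_pos hpos hprod
    rw [hAB, Set.inter_comm]
    exact (ENNReal.toReal_pos_iff.1 h4).1

/-- Words whose occupation measures are eventually close to a given point of the simplex. -/
lemma eventually_exists_word_near {d m : ℕ} {x : Fin m → Fin d → ℝ} (hx : x ∈ simplexD d m)
    {ε : ℝ} (hε : 0 < ε) : ∀ᶠ n : ℕ in atTop, ∃ w : ℕ → Fin m → Fin d,
      ‖occ d m (fun k (_ : Unit) => w k) n () - x‖ ≤ ε := by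
  have hlim : Tendsto (fun n : ℕ => (1 + d : ℝ) / n + √2 * (1 / √n)) atTop (nhds 0) := by
    have h1 : Tendsto (fun n : ℕ => (1 + d : ℝ) / n) atTop (nhds 0) :=
      tendsto_const_div_atTop_nhds_zero_nat _
    have h2 : Tendsto (fun n : ℕ => 1 / √(n : ℝ)) atTop (nhds 0) :=
      tendsto_const_nhds.div_atTop (Real.tendsto_sqrt_atTop.comp tendsto_natCast_atTop_atTop)
    simpa using h1.add (h2.const_mul √2)
  filter_upwards [hlim.eventually_lt_const hε, eventually_ge_atTop 1] with n hn hn1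
  choose s hs using fun i => exists_word_balanced (x i) (hx i).1 (hx i).2 n
  refine ⟨fun k i => s i k, (pi_norm_le_iff_of_nonneg hε.le).2 fun i =>
    (pi_norm_le_iff_of_nonneg hε.le).2 fun v => ?_⟩
  rw [Real.norm_eq_abs]
  set D := (∑ k ∈ Finset.Icc 1 n, if s i k = v then (1 : ℝ) else 0) - n * x i v with hD
  have hDsq : D ^ 2 ≤ 2 * n :=
    (Finset.single_le_sum (f := fun v =>
      ((∑ k ∈ Finset.Icc 1 n, if s i k = v then (1 : ℝ) else 0) - n * x i v) ^ 2)
      (fun _ _ => sq_nonneg _) (Finset.mem_univ v)).trans (hs i)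
  have hDabs : |D| ≤ √2 * √n := by
    rw [← Real.sqrt_mul (by norm_num)]
    exact Real.abs_le_sqrt hDsq
  have hn0 : (0 : ℝ) < n := by exact_mod_cast hn1
  have hd0 : (0 : ℝ) ≤ d := Nat.cast_nonneg d
  have hx0 := (hx i).1 v
  have hx1 : x i v ≤ 1 := (hx i).2 ▸ Finset.single_le_sum (fun w _ => (hx i).1 w) (by simp)
  have heq : (occ d m (fun k (_ : Unit) => fun i => s i k) n () - x) i v
      = (D + (1 - d * x i v)) / (d + n) := by
    simp only [Pi.sub_apply, occ, hD]
    field_simp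
    ring
  rw [heq, abs_div, abs_of_pos (show (0 : ℝ) < d + n by positivity)]
  have hnum : |D + (1 - d * x i v)| ≤ √2 * √n + (1 + d) := by
    refine (abs_add_le _ _).trans (add_le_add hDabs (abs_le.2 ⟨?_, ?_⟩)) <;> nlinarith
  calc |D + (1 - d * x i v)| / (d + n) ≤ (√2 * √n + (1 + d)) / n := by
        refine div_le_div₀ (by positivity) hnum hn0 (by linarith)
    _ = (1 + d : ℝ) / n + √2 * (1 / √n) := by
        have hsq : √(n : ℝ) * √n = n := Real.mul_self_sqrt hn0.le
        have hs0 : 0 < √(n : ℝ) := Real.sqrt_pos.2 hn0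
        rw [add_div, add_comm]
        congr 1
        rw [div_eq_iff hn0.ne']
        nth_rw 3 [← hsq]
        field_simp
    _ ≤ ε := hn.le

open Matrix in
/-- One-step decrease, on average, of the quadratic Lyapunov function. -/
lemma setIntegral_lyapunov_step {d m : ℕ} {Ω : Type*} {m₀ : MeasurableSpace Ω} (ℙ : Measure Ω)
    [IsProbabilityMeasure ℙ] {W : ℕ → Ω → Fin m → Fin d} {ℱ : Filtration ℕ m₀}
    {α : Fin d → Fin m → Fin m → ℝ} {x : Fin m → Fin d → ℝ} (hx : x ∈ simplexD d m)
    (hWmeas : ∀ n, Measurable (W n)) (hocc : ∀ n, Measurable[ℱ n] (occ d m W n))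
    (hcond : ∀ n (i : Fin m) (v : Fin d),
      (ℙ[fun ω => if W (n + 1) ω i = v then (1 : ℝ) else 0 | ℱ n])
        =ᵐ[ℙ] fun ω => piMap d m α (occ d m W n ω) i v)
    {P : Matrix (Fin m × Fin d) (Fin m × Fin d) ℝ} (hP : P.IsSymm) {r c : ℝ}
    (hdrift : ∀ y, flat (y - x) ⬝ᵥ (P *ᵥ flat (y - x)) ≤ r →
        flat (y - x) ⬝ᵥ (P *ᵥ flat (FF d m α y)) ≤ -c * (flat (y - x) ⬝ᵥ (P *ᵥ flat (y - x))))
    {V : ℕ → Ω → ℝ}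
    (hV : ∀ n ω, V n ω = flat (occ d m W n ω - x) ⬝ᵥ (P *ᵥ flat (occ d m W n ω - x)))
    (hVint : ∀ n, Integrable (V n) ℙ)
    (n : ℕ) {E : Set Ω} (hE : MeasurableSet[ℱ n] E) (hEr : ∀ ω ∈ E, V n ω ≤ r) :
    ∫ ω in E, V (n + 1) ω ∂ℙ ≤ (1 - 2 * c / (d + n + 1)) * ∫ ω in E, V n ω ∂ℙ
      + (∑ p, ∑ q, |P p q|) / (d + n + 1) ^ 2 * ℙ.real E := by
  have hEm : MeasurableSet E := ℱ.le n _ hE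
  set γ : ℝ := 1 / (d + n + 1) with hγ
  have hγ0 : 0 < γ := by positivity
  set K : ℝ := ∑ p, ∑ q, |P p q| with hK
  set f : Fin m × Fin d → Ω → ℝ := fun q ω => (flat (occ d m W n ω - x) ᵥ* P) q with hf
  set ξ : Fin m × Fin d → Ω → ℝ := fun q ω => if W (n + 1) ω q.1 = q.2 then 1 else 0 with hξ
  set X : Fin m × Fin d → Ω → ℝ := fun q ω => occ d m W n ω q.1 q.2 with hX
  set ϖ : Fin m × Fin d → Ω → ℝ := fun q ω => piMap d m α (occ d m W n ω) q.1 q.2 with hϖ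
  have hz1 : ∀ ω q, |flat (occ d m W n ω - x) q| ≤ 1 := by
    intro ω q
    have h1 := occ_mem_Icc (W := W) n ω q.1 q.2
    have h2 := (hx q.1).1 q.2
    have h3 : x q.1 q.2 ≤ 1 :=
      (hx q.1).2 ▸ Finset.single_le_sum (fun w _ => (hx q.1).1 w) (by simp)
    simp only [flat, Pi.sub_apply]
    exact abs_le.2 ⟨by linarith [h1.1], by linarith [h1.2]⟩
  have hfcont : ∀ q, Continuous fun y : Fin m → Fin d → ℝ => (flat (y - x) ᵥ* P) q := by
    intro q
    simp only [vecMul, dotProduct, flat, Pi.sub_apply]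
    fun_prop
  have hfm : ∀ q, StronglyMeasurable[ℱ n] (f q) := fun q =>
    ((hfcont q).measurable.comp (hocc n)).stronglyMeasurable
  have hfb : ∀ q ω, |f q ω| ≤ K := by
    intro q ω
    simp only [hf, vecMul, dotProduct]
    refine (Finset.abs_sum_le_sum_abs _ _).trans (Finset.sum_le_sum fun p _ => ?_)
    rw [abs_mul]
    have h1 : |P p q| ≤ ∑ q, |P p q| :=
      Finset.single_le_sum (f := fun q => |P p q|) (fun _ _ => abs_nonneg _) (Finset.mem_univ q)
    exact (mul_le_of_le_one_left (abs_nonneg _) (hz1 ω p)).trans h1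
  have hbdd : ∀ {g : Ω → ℝ} {C : ℝ}, Measurable g → (∀ ω, |g ω| ≤ C) → Integrable g ℙ :=
    fun hg hC => Integrable.of_bound hg.aestronglyMeasurable _
      (ae_of_all _ fun ω => by simpa using hC ω)
  have hξm : ∀ q, Measurable (ξ q) := fun q =>
    (measurable_of_countable (fun u : Fin m → Fin d => if u q.1 = q.2 then (1 : ℝ) else 0)).comp
      (hWmeas (n + 1))
  have hξi : ∀ q, Integrable (ξ q) ℙ := fun q => hbdd (C := 1) (hξm q) fun ω => by
    simp only [hξ]; split_ifs <;> simp
  have hocc0 : Measurable (occ d m W n) := (hocc n).mono (ℱ.le n) le_rfl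
  have hXi : ∀ q, Integrable (X q) ℙ := fun q => hbdd (C := 1)
    ((measurable_pi_apply q.2).comp ((measurable_pi_apply q.1).comp hocc0)) fun ω => by
      have h1 := occ_mem_Icc (W := W) n ω q.1 q.2
      exact abs_le.2 ⟨by linarith [h1.1], h1.2⟩
  have hmul : ∀ q {g : Ω → ℝ}, Integrable g ℙ → Integrable (fun ω => f q ω * g ω) ℙ :=
    fun q g hg => hg.bdd_mul ((hfm q).mono (ℱ.le n)).aestronglyMeasurable
      (ae_of_all _ fun ω => by simpa using hfb q ω)
  have hϖi : ∀ q, Integrable (ϖ q) ℙ := fun q =>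
    integrable_condExp.congr (hcond n q.1 q.2)
  have hpt : ∀ ω, V (n + 1) ω ≤ V n ω + 2 * γ * ∑ q, f q ω * (ξ q ω - X q ω) + γ ^ 2 * K := by
    intro ω
    set z := flat (occ d m W n ω - x) with hz
    set u : Fin m × Fin d → ℝ := fun q => ξ q ω - X q ω with hu
    have hstep : flat (occ d m W (n + 1) ω - x) = z + γ • u := by
      ext q
      simp only [hz, hu, flat, Pi.sub_apply, Pi.add_apply, Pi.smul_apply, smul_eq_mul, occ_succ,
        hξ, hX]
      ring
    have hsym : u ⬝ᵥ (P *ᵥ z) = z ⬝ᵥ (P *ᵥ u) := by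
      rw [dotProduct_mulVec, dotProduct_comm, ← mulVec_transpose, hP.eq]
    have hu1 : ∀ q, |u q| ≤ 1 := by
      intro q
      have h1 := occ_mem_Icc (W := W) n ω q.1 q.2
      simp only [hu, hξ, hX]
      split_ifs <;> exact abs_le.2 ⟨by linarith [h1.1, h1.2], by linarith [h1.1, h1.2]⟩
    have huK : u ⬝ᵥ (P *ᵥ u) ≤ K := by
      simpa using dotProduct_mulVec_le_of_abs_le P hu1 hu1
    have hsum : ∑ q, f q ω * (ξ q ω - X q ω) = z ⬝ᵥ (P *ᵥ u) := by
      rw [dotProduct_mulVec]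
      rfl
    rw [hsum, hV, hV, hstep]
    simp only [mulVec_add, mulVec_smul, add_dotProduct, dotProduct_add, smul_dotProduct,
      dotProduct_smul, smul_eq_mul, hsym]
    nlinarith [mul_le_mul_of_nonneg_left huK (sq_nonneg γ)]
  have hdiff : ∀ q {g h : Ω → ℝ}, Integrable g ℙ → Integrable h ℙ →
      Integrable (fun ω => f q ω * (g ω - h ω)) ℙ := fun q _ _ hg hh => hmul q (hg.sub hh)
  have hsumint : ∀ (g h : Fin m × Fin d → Ω → ℝ), (∀ q, Integrable (g q) ℙ) →
      (∀ q, Integrable (h q) ℙ) → Integrable (fun ω => ∑ q, f q ω * (g q ω - h q ω)) ℙ :=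
    fun g h hg hh => integrable_finsetSum _ fun q _ => hdiff q (hg q) (hh q)
  have hexch : ∫ ω in E, ∑ q, f q ω * (ξ q ω - X q ω) ∂ℙ
      = ∫ ω in E, ∑ q, f q ω * (ϖ q ω - X q ω) ∂ℙ := by
    rw [integral_finsetSum _ fun q _ => (hdiff q (hξi q) (hXi q)).integrableOn,
      integral_finsetSum _ fun q _ => (hdiff q (hϖi q) (hXi q)).integrableOn]
    refine Finset.sum_congr rfl fun q _ => ?_
    simp only [mul_sub]
    rw [integral_sub (hmul q (hξi q)).integrableOn (hmul q (hXi q)).integrableOn,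
      integral_sub (hmul q (hϖi q)).integrableOn (hmul q (hXi q)).integrableOn,
      setIntegral_mul_of_condExp_ae_eq (ℱ.le n) (hfm q) (hfb q) (hξi q) (hcond n q.1 q.2) hE]
  have hdr : ∫ ω in E, ∑ q, f q ω * (ϖ q ω - X q ω) ∂ℙ ≤ ∫ ω in E, -c * V n ω ∂ℙ := by
    refine setIntegral_mono_on (hsumint _ _ hϖi hXi).integrableOn
      ((hVint n).const_mul _).integrableOn hEm fun ω hω => ?_
    have h1 := hdrift (occ d m W n ω) (by rw [← hV]; exact hEr ω hω)
    rw [← hV, dotProduct_mulVec] at h1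
    refine le_trans (le_of_eq ?_) h1
    refine Finset.sum_congr rfl fun q _ => ?_
    simp only [hf, hϖ, hX, flat, FF]
    ring
  have hmart : Integrable (fun ω => 2 * γ * ∑ q, f q ω * (ξ q ω - X q ω)) ℙ :=
    (hsumint _ _ hξi hXi).const_mul _
  have hpart : Integrable (fun ω => V n ω + 2 * γ * ∑ q, f q ω * (ξ q ω - X q ω)) ℙ :=
    (hVint n).add hmart
  have hmono : ∫ ω in E, V (n + 1) ω ∂ℙ
      ≤ ∫ ω in E, (V n ω + 2 * γ * ∑ q, f q ω * (ξ q ω - X q ω) + γ ^ 2 * K) ∂ℙ :=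
    setIntegral_mono (hVint _).integrableOn
      (hpart.add (integrable_const _)).integrableOn hpt
  rw [integral_add hpart.integrableOn (integrable_const _),
    integral_add (hVint n).integrableOn hmart.integrableOn, integral_const_mul, hexch,
    setIntegral_const, smul_eq_mul] at hmono
  rw [integral_const_mul] at hdr
  have h1 : 2 * γ * ∫ ω in E, ∑ q, f q ω * (ϖ q ω - X q ω) ∂ℙ
      ≤ 2 * γ * (-c * ∫ ω in E, V n ω ∂ℙ) := mul_le_mul_of_nonneg_left hdr (by positivity)
  have h2 : 2 * c / ((d : ℝ) + n + 1) = 2 * γ * c := by rw [hγ]; ring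
  have h3 : K / ((d : ℝ) + n + 1) ^ 2 = γ ^ 2 * K := by rw [hγ]; field_simp
  rw [h2, h3]
  linarith

lemma rpow_weight_step {N c δ : ℝ} (hN : 1 ≤ N) (hδ0 : 0 ≤ δ) (hδ1 : δ ≤ 1) (hδc : δ ≤ c) :
    (N + 1) ^ δ * (1 - 2 * c / (N + 1)) ≤ N ^ δ := by
  have hN0 : 0 < N := by linarith
  rcases le_or_gt (1 - 2 * c / (N + 1)) 0 with h | h
  · exact (mul_nonpos_of_nonneg_of_nonpos (by positivity) h).trans (by positivity)
  · have h1 : (N + 1) ^ δ ≤ N ^ δ * (1 + δ * (1 / N)) := by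
      have : N + 1 = N * (1 + 1 / N) := by field_simp
      rw [this, Real.mul_rpow hN0.le (by positivity)]
      have hinv : 0 < 1 / N := by positivity
      exact mul_le_mul_of_nonneg_left
        (rpow_one_add_le_one_add_mul_self (by linarith) hδ0 hδ1) (by positivity)
    have h2 : δ * (1 / N) ≤ 2 * c / (N + 1) := by
      rw [mul_one_div, div_le_div_iff₀ hN0 (by linarith)]
      nlinarith
    have h3 : 0 ≤ δ * (1 / N) := by positivity
    calc (N + 1) ^ δ * (1 - 2 * c / (N + 1))
        ≤ N ^ δ * (1 + δ * (1 / N)) * (1 - 2 * c / (N + 1)) := mul_le_mul_of_nonneg_right h1 h.le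
      _ = N ^ δ * ((1 + δ * (1 / N)) * (1 - 2 * c / (N + 1))) := by ring
      _ ≤ N ^ δ * 1 := mul_le_mul_of_nonneg_left (by nlinarith) (by positivity)
      _ = N ^ δ := mul_one _

lemma summable_rpow_weight {δ : ℝ} (hδ : δ ≤ 1 / 2) (d : ℕ) (K : ℝ) :
    Summable fun n : ℕ => ((d : ℝ) + n + 1) ^ δ * (K / (d + n + 1) ^ 2) := by
  have h : Summable fun n : ℕ => K * (((n + (d + 1) : ℕ) : ℝ) ^ (δ - 2)) :=
    ((summable_nat_add_iff (d + 1)).2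
      (Real.summable_nat_rpow.2 (by linarith : δ - 2 < -1))).mul_left K
  refine h.congr fun n => ?_
  have hp : (0 : ℝ) < d + n + 1 := by positivity
  have hc : ((n + (d + 1) : ℕ) : ℝ) = d + n + 1 := by push_cast; ring
  rw [hc, Real.rpow_sub hp, Real.rpow_two]
  ring

lemma eventually_sum_Ico_le {b : ℕ → ℝ} (hb : Summable b) (hb0 : ∀ n, 0 ≤ b n) {ε : ℝ}
    (hε : 0 < ε) : ∀ᶠ n₀ in atTop, ∀ n, ∑ k ∈ Finset.Ico n₀ n, b k ≤ ε := by
  filter_upwards [(tendsto_sum_nat_add b).eventually_lt_const hε] with n₀ h n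
  rw [Finset.sum_Ico_eq_sum_range]
  have h1 : Summable fun k => b (k + n₀) := (summable_nat_add_iff n₀).2 hb
  refine le_trans ?_ h.le
  simp_rw [add_comm n₀]
  exact h1.sum_le_tsum _ fun _ _ => hb0 _

/-- For each linearly stable equilibrium point `x` of `F`, the vertex occupation measure
process converges to `x` with positive probability. -/
theorem pos_prob_convergence_to_stable_equilibrium (d m : ℕ) (hd : 2 ≤ d) (hm : 2 ≤ m)
    (α : Fin d → Fin m → Fin m → ℝ) (hsym : ∀ v i j, α v i j = α v j i)
    {Ω : Type*} [MeasurableSpace Ω] (ℙ : Measure Ω) [IsProbabilityMeasure ℙ]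
    (W : ℕ → Ω → Fin m → Fin d) (hWmeas : ∀ n, Measurable (W n))
    (ℱ : Filtration ℕ ‹MeasurableSpace Ω›)
    (hℱ : ∀ n, ℱ n = ⨆ k ∈ Finset.Icc 1 n, MeasurableSpace.comap (W k) ⊤)
    (hcond : ∀ n (i : Fin m) (v : Fin d),
      (ℙ[fun ω => if W (n + 1) ω i = v then (1 : ℝ) else 0 | ℱ n])
        =ᵐ[ℙ] fun ω => piMap d m α (occ d m W n ω) i v)
    (hindep : ∀ n (v : Fin m → Fin d),
      (ℙ[fun ω => if (∀ i, W (n + 1) ω i = v i) then (1 : ℝ) else 0 | ℱ n])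
        =ᵐ[ℙ] fun ω => ∏ i, piMap d m α (occ d m W n ω) i (v i))
    (x : Fin m → Fin d → ℝ) (hx : x ∈ simplexD d m)
    (hxeq : FF d m α x = 0) (hxstable : LinStable d m α x) :
    0 < ℙ {ω | Tendsto (fun n => occ d m W n ω) atTop (nhds x)} := by
  obtain ⟨P, hP, hPpos, r, hr, c, hc, hdrift⟩ := exists_lyapunov_drift α x hxeq hxstable
  have hocc := measurable_occ hℱ
  set K : ℝ := ∑ p, ∑ q, |P p q| with hK
  have hK0 : 0 ≤ K := Finset.sum_nonneg fun _ _ => Finset.sum_nonneg fun _ _ => abs_nonneg _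
  set q : (Fin m → Fin d → ℝ) → ℝ :=
    fun y => flat (y - x) ⬝ᵥ P.mulVec (flat (y - x)) with hq
  have hqnorm : ∀ y, ‖y - x‖ ^ 2 ≤ q y := fun y => (norm_sq_le_flat _).trans (hPpos _)
  have hqle : ∀ y, q y ≤ ‖y - x‖ * ‖y - x‖ * K := fun y =>
    dotProduct_mulVec_le_of_abs_le P (abs_flat_le _) (abs_flat_le _)
  have hqcont : Continuous q := by
    simp only [hq, dotProduct, Matrix.mulVec, flat, Pi.sub_apply]
    fun_prop
  set V : ℕ → Ω → ℝ := fun n ω => q (occ d m W n ω) with hV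
  have hVm : ∀ n, Measurable[ℱ n] (V n) := fun n => hqcont.measurable.comp (hocc n)
  have hV0 : ∀ n ω, 0 ≤ V n ω := fun n ω => (sq_nonneg _).trans (hqnorm _)
  have hVK : ∀ n ω, V n ω ≤ K := by
    intro n ω
    have hle : ‖occ d m W n ω - x‖ ≤ 1 := by
      refine (pi_norm_le_iff_of_nonneg zero_le_one).2 fun i =>
        (pi_norm_le_iff_of_nonneg zero_le_one).2 fun v => ?_
      have h1 := occ_mem_Icc (W := W) n ω i v
      have h2 := (hx i).1 v
      have h3 : x i v ≤ 1 := (hx i).2 ▸ Finset.single_le_sum (fun w _ => (hx i).1 w) (by simp)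
      exact abs_le.2 ⟨by simp only [Pi.sub_apply]; linarith [h1.1],
        by simp only [Pi.sub_apply]; linarith [h1.2]⟩
    have := norm_nonneg (occ d m W n ω - x)
    exact (hqle _).trans (mul_le_of_le_one_left hK0 (by nlinarith))
  have hVint : ∀ n, Integrable (V n) ℙ := fun n =>
    Integrable.of_bound ((hVm n).mono (ℱ.le n) le_rfl).aestronglyMeasurable K
      (ae_of_all _ fun ω => by rw [Real.norm_of_nonneg (hV0 n ω)]; exact hVK n ω)
  set δ : ℝ := min c (1 / 2) with hδ
  have hδ0 : 0 < δ := lt_min hc (by norm_num)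
  have hδh : δ ≤ 1 / 2 := min_le_right _ _
  set w : ℕ → ℝ := fun n => ((d : ℝ) + n) ^ δ with hw
  have hd1 : (1 : ℝ) ≤ d := by exact_mod_cast (by omega : 1 ≤ d)
  have hbase : ∀ n : ℕ, (1 : ℝ) ≤ d + n := fun n => by
    have : (0 : ℝ) ≤ n := Nat.cast_nonneg n
    linarith
  have hw1 : ∀ n, 1 ≤ w n := fun n => Real.one_le_rpow (hbase n) hδ0.le
  have hwsucc : ∀ n, w (n + 1) = ((d : ℝ) + n + 1) ^ δ := fun n => by
    simp only [hw]; push_cast; rw [add_assoc]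
  set b : ℕ → ℝ := fun n => ((d : ℝ) + n + 1) ^ δ * (K / (d + n + 1) ^ 2) with hb
  have hb0 : ∀ n, 0 ≤ b n := fun n => by simp only [hb]; positivity
  set ε : ℝ := min 1 (r / (4 * (K + 1))) with hε
  have hε0 : 0 < ε := lt_min one_pos (by positivity)
  obtain ⟨n₀, ⟨u, hu⟩, hbsum⟩ := ((eventually_exists_word_near hx hε0).and
    (eventually_sum_Ico_le (summable_rpow_weight hδh d K) hb0
      (show 0 < r / 4 by positivity))).exists
  obtain ⟨hAm, hApos⟩ := measure_word_pos ℙ α hℱ hindep u n₀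
  set A : Set Ω := {ω | ∀ k ∈ Finset.Icc 1 n₀, W k ω = u k} with hA
  have hAV : ∀ ω ∈ A, V n₀ ω ≤ r / 4 := by
    intro ω hω
    have h1 : occ d m W n₀ ω = occ d m (fun k (_ : Unit) => u k) n₀ () := by
      ext i v
      simp only [occ]
      congr 2
      exact Finset.sum_congr rfl fun k hk => by rw [hω k hk]
    rw [← h1] at hu
    have h2 := norm_nonneg (occ d m W n₀ ω - x)
    have h3 : ε ≤ 1 := min_le_left _ _
    have h4 : ε * (4 * (K + 1)) ≤ r := (le_div_iff₀ (by positivity)).1 (min_le_right _ _)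
    have h5 : ‖occ d m W n₀ ω - x‖ * ‖occ d m W n₀ ω - x‖ ≤ ε := by nlinarith
    have h6 := mul_le_mul_of_nonneg_right h5 hK0
    have := hqle (occ d m W n₀ ω)
    simp only [hV]
    linarith
  have hR : 0 < r * w n₀ := mul_pos hr (one_pos.trans_le (hw1 n₀))
  have hmain := measure_forall_le_pos_of_step (μ := ℙ) (ℱ := ℱ) (Z := fun n ω => w n * V n ω)
    (n₀ := n₀) (R := r * w n₀) (b := b) (A := A)
    (fun n => (hVm n).const_mul _) (fun n => (hVint n).const_mul _)
    (fun n ω => mul_nonneg (zero_le_one.trans (hw1 n)) (hV0 n ω)) hR hb0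
    (fun n => (hbsum n).trans (by have := hw1 n₀; nlinarith)) ?_ hAm
    (fun ω hω => by have := hAV ω hω; have := hw1 n₀; nlinarith) hApos
  · refine hmain.trans_le (measure_mono fun ω hω => ?_)
    have hV' : ∀ᶠ n in atTop, ‖occ d m W n ω - x‖ ^ 2 ≤ r * w n₀ / w n := by
      filter_upwards [eventually_ge_atTop n₀] with n hn
      have h1 := hω.2 n hn
      refine (hqnorm _).trans ((le_div_iff₀ (one_pos.trans_le (hw1 n))).2 ?_)
      rw [mul_comm]
      exact h1
    have hwlim : Tendsto w atTop atTop :=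
      (tendsto_rpow_atTop hδ0).comp
        (tendsto_atTop_add_const_left _ _ tendsto_natCast_atTop_atTop)
    have hlim : Tendsto (fun n => ‖occ d m W n ω - x‖ ^ 2) atTop (nhds 0) :=
      squeeze_zero' (Eventually.of_forall fun _ => sq_nonneg _) hV'
        (tendsto_const_nhds.div_atTop hwlim)
    have hlim2 := (Real.continuous_sqrt.tendsto 0).comp hlim
    simp only [Function.comp_def, Real.sqrt_zero, Real.sqrt_sq (norm_nonneg _)] at hlim2
    exact tendsto_iff_norm_sub_tendsto_zero.2 hlim2
  · intro n hn E hE hEZ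
    have hmonow : w n₀ ≤ w n := Real.rpow_le_rpow (by positivity)
      (by have : (n₀ : ℝ) ≤ n := by exact_mod_cast hn
          linarith) hδ0.le
    have hEr : ∀ ω ∈ E, V n ω ≤ r := by
      intro ω hω
      have h1 : w n * V n ω ≤ w n * r := by
        refine (hEZ ω hω).trans ?_
        rw [mul_comm]
        exact mul_le_mul_of_nonneg_right hmonow hr.le
      exact le_of_mul_le_mul_left h1 (one_pos.trans_le (hw1 n))
    have hstep := setIntegral_lyapunov_step ℙ hx hWmeas hocc hcond hP hdrift (V := V)
      (fun _ _ => rfl) hVint n hE hEr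
    have hwn := rpow_weight_step (hbase n) hδ0.le (by linarith) (min_le_left c (1 / 2))
    have hI : 0 ≤ ∫ ω in E, V n ω ∂ℙ := integral_nonneg fun ω => hV0 n ω
    have h1 := mul_le_mul_of_nonneg_left hstep (zero_le_one.trans (hw1 (n + 1)))
    have h2 := mul_le_mul_of_nonneg_right hwn hI
    rw [integral_const_mul, integral_const_mul]
    rw [hwsucc] at h1 ⊢
    simp only [hb, hw]
    linarith
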